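/- Assume the hypotheses of the energy-decay theorem for the H¹-scheme and the eigengap assumption λ₁ > λ₀. There exists a constant L_g, depending only on Ω, d, β, V, u*, and ‖u₀‖_{H^1_0(Ω)}, such that if in addition the stepsizes satisfy α_n ≤ α_max with 1 + L_g²α_max² − α_max·min{1, (λ₁−λ₀)/(4λ₀)} < 1, then the sequence {u_n} generated by the H¹-scheme with initial condition u₀ sufficiently close to u* converges exponentially in H^1_0(Ω) to the ground state u*: there is C_δ ∈ (0,1) with ‖u_{n+1} − u*‖_{H^1_0(Ω)} ≤ C_δ·‖u_n − u*‖_{H^1_0(Ω)} for all n. -/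

import Mathlib

open scoped RealInnerProductSpace
open Filter Topology

/-- Abstract setting for the Gross–Pitaevskii eigenvalue problem on a bounded
Lipschitz domain `Ω ⊆ ℝᵈ` (`d ∈ {1,2,3}`) with potential `0 ≤ V ≤ Vmax` in
`L^∞(Ω)` and interaction parameter `β ≥ 0`.

The Hilbert space `H` plays the role of `H¹₀(Ω)` equipped with the inner product
`(z,w)_{H¹₀} = (∇z,∇w)_{L²}`; `P z w` is the `L²(Ω)` inner product `∫ z w`,
`Vf z w = ∫ V z w`, and `Q4 a b c d = ∫ a b c d` (defined on `H` thanks to the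
Sobolev embedding `H¹₀ ↪ L⁴` valid for `d ≤ 3`).

`C₁`, `C₂`, `C₃` are, respectively, the constants of the embedding
`‖u‖_{L⁴} ≤ C₁ ‖u‖_{H¹₀}`, of the embedding `‖·‖_{H⁻¹} ≤ C₂ ‖·‖_{L^{4/3}}`,
and of the Poincaré inequality `‖u‖_{L²} ≤ C₃ ‖u‖_{H¹₀}`.

`G`, `GV`, `Gc` are, respectively, `G_{H¹}`, `u ↦ G_{H¹}(V u)` and
`u ↦ G_{H¹}(|u|² u)`, characterized by their defining Riesz identities
(`Gc_bound` encodes `‖G_{H¹}(|u|²u)‖_{H¹₀} ≤ ‖u³‖_{H⁻¹} ≤ C₂ ‖u³‖_{L^{4/3}}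
= C₂ ‖u‖_{L⁴}³`).  `G0`, `G0c` are the analogous Green operators for the
`a₀`-inner product `(z,w)_{a₀} = ∫ ∇z·∇w + V z w`, and `Gau u` is the Green
operator for the `a_u`-inner product
`(z,w)_{a_u} = ∫ ∇z·∇w + V z w + β|u|² z w`. -/
structure GPSetting (H : Type*) [NormedAddCommGroup H] [InnerProductSpace ℝ H] where
  /-- the `L²(Ω)` inner product `(z,w)_{L²} = ∫ z w` on `H = H¹₀(Ω)` -/
  P : H →ₗ[ℝ] H →ₗ[ℝ] ℝ
  P_symm : ∀ z w : H, P z w = P w z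
  P_nonneg : ∀ z : H, 0 ≤ P z z
  P_definite : ∀ z : H, P z z = 0 → z = 0
  /-- `Vmax`, the (essential) upper bound of the potential `V` -/
  Vmax : ℝ
  Vmax_nonneg : 0 ≤ Vmax
  /-- the bilinear form `Vf z w = ∫ V z w` -/
  Vf : H →ₗ[ℝ] H →ₗ[ℝ] ℝ
  Vf_symm : ∀ z w : H, Vf z w = Vf w z
  Vf_nonneg : ∀ z : H, 0 ≤ Vf z z
  Vf_le : ∀ z : H, Vf z z ≤ Vmax * P z z
  /-- the interaction parameter `β ≥ 0` -/
  β : ℝ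
  β_nonneg : 0 ≤ β
  /-- the quadrilinear form `Q4 a b c d = ∫ a b c d` -/
  Q4 : H →ₗ[ℝ] H →ₗ[ℝ] H →ₗ[ℝ] H →ₗ[ℝ] ℝ
  Q4_symm₁ : ∀ a b c d : H, Q4 a b c d = Q4 b a c d
  Q4_symm₂ : ∀ a b c d : H, Q4 a b c d = Q4 a c b d
  Q4_symm₃ : ∀ a b c d : H, Q4 a b c d = Q4 a b d c
  Q4_sq_nonneg : ∀ z w : H, 0 ≤ Q4 z z w w
  /-- the constant of the Sobolev embedding `‖u‖_{L⁴} ≤ C₁ ‖u‖_{H¹₀}` -/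
  C₁ : ℝ
  C₁_pos : 0 < C₁
  embed_L4 : ∀ u : H, Q4 u u u u ≤ C₁ ^ 4 * ‖u‖ ^ 4
  /-- the constant of the embedding `‖·‖_{H⁻¹} ≤ C₂ ‖·‖_{L^{4/3}}` -/
  C₂ : ℝ
  C₂_pos : 0 < C₂
  /-- the Poincaré constant: `‖u‖_{L²} ≤ C₃ ‖u‖_{H¹₀}` -/
  C₃ : ℝ
  C₃_pos : 0 < C₃
  poincare : ∀ u : H, P u u ≤ C₃ ^ 2 * ‖u‖ ^ 2
  /-- the Green operator `G_{H¹}`: `(z, G_{H¹} w)_{H¹₀} = (z,w)_{L²}` -/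
  G : H →ₗ[ℝ] H
  G_def : ∀ z w : H, ⟪z, G w⟫ = P z w
  /-- `GV w = G_{H¹}(V w)`: `(z, G_{H¹}(Vw))_{H¹₀} = ∫ V z w` -/
  GV : H →ₗ[ℝ] H
  GV_def : ∀ z w : H, ⟪z, GV w⟫ = Vf z w
  /-- `Gc w = G_{H¹}(|w|² w)`: `(z, G_{H¹}(w³))_{H¹₀} = ∫ z w³` -/
  Gc : H → H
  Gc_def : ∀ z w : H, ⟪z, Gc w⟫ = Q4 z w w w
  Gc_bound : ∀ w : H, ‖Gc w‖ ≤ C₂ * (Q4 w w w w) ^ ((3 : ℝ) / 4)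
  /-- the Green operator `G_{a₀}`: `(z, G_{a₀} w)_{a₀} = (z,w)_{L²}` -/
  G0 : H →ₗ[ℝ] H
  G0_def : ∀ z w : H, ⟪z, G0 w⟫ + Vf z (G0 w) = P z w
  /-- `G0c w = G_{a₀}(|w|² w)` -/
  G0c : H → H
  G0c_def : ∀ z w : H, ⟪z, G0c w⟫ + Vf z (G0c w) = Q4 z w w w
  /-- the Green operator `G_{a_u}`: `(z, G_{a_u} w)_{a_u} = (z,w)_{L²}` -/
  Gau : H → H → H
  Gau_def : ∀ u z w : H,
    ⟪z, Gau u w⟫ + Vf z (Gau u w) + β * Q4 u u z (Gau u w) = P z w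

namespace GPSetting

variable {H : Type*} [NormedAddCommGroup H] [InnerProductSpace ℝ H] (S : GPSetting H)

/-- the `L²(Ω)` norm -/
noncomputable def l2norm (u : H) : ℝ := Real.sqrt (S.P u u)

/-- the `L⁴(Ω)` norm -/
noncomputable def l4norm (u : H) : ℝ := (S.Q4 u u u u) ^ ((1 : ℝ) / 4)

/-- the `H⁻¹(Ω)` (dual) norm of an element of `H¹₀(Ω)` -/
noncomputable def HnegNorm (u : H) : ℝ := ⨆ z : {z : H // ‖z‖ ≤ 1}, S.P z.1 u

/-- the manifold `M = {u ∈ H¹₀(Ω) : ‖u‖_{L²} = 1}` -/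
def Msphere : Set H := {u : H | S.P u u = 1}

/-- the Gross–Pitaevskii energy
`E(u) = ∫ (1/2)|∇u|² + (1/2)V|u|² + (β/4)|u|⁴` -/
noncomputable def energy (u : H) : ℝ :=
  (1 / 2) * ‖u‖ ^ 2 + (1 / 2) * S.Vf u u + (S.β / 4) * S.Q4 u u u u

/-- the retraction `R(u) = u / ‖u‖_{L²}` -/
noncomputable def retract (u : H) : H := (S.l2norm u)⁻¹ • u

/-- the `H¹`-gradient `∇_{H¹}E(u) = u + G_{H¹}(Vu + β|u|²u)` -/
noncomputable def gradH1 (u : H) : H := u + S.GV u + S.β • S.Gc u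

/-- the Riemannian `H¹`-gradient
`∇^R_{H¹}E(u) = ∇_{H¹}E(u) − ((∇_{H¹}E(u),u)_{L²}/‖G_{H¹}u‖²_{H¹₀}) G_{H¹}u` -/
noncomputable def gradRH1 (u : H) : H :=
  S.gradH1 u - (S.P (S.gradH1 u) u / ‖S.G u‖ ^ 2) • S.G u

/-- the `a₀`-inner product `(z,w)_{a₀} = ∫ ∇z·∇w + Vzw` -/
noncomputable def a0inner (z w : H) : ℝ := ⟪z, w⟫ + S.Vf z w

/-- the `a₀`-norm -/
noncomputable def a0norm (z : H) : ℝ := Real.sqrt (S.a0inner z z)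

/-- the `a₀`-gradient `∇_{a₀}E(u) = u + β G_{a₀}(|u|²u)` -/
noncomputable def gradA0 (u : H) : H := u + S.β • S.G0c u

/-- the Riemannian `a₀`-gradient
`∇^R_{a₀}E(u) = ∇_{a₀}E(u) − ((∇_{a₀}E(u),u)_{L²}/‖G_{a₀}u‖²_{a₀}) G_{a₀}u` -/
noncomputable def gradRA0 (u : H) : H :=
  S.gradA0 u - (S.P (S.gradA0 u) u / (S.a0norm (S.G0 u)) ^ 2) • S.G0 u

/-- the `a_u`-inner product `(z,w)_{a_u} = ∫ ∇z·∇w + Vzw + β|u|²zw` -/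
noncomputable def auinner (u z w : H) : ℝ :=
  ⟪z, w⟫ + S.Vf z w + S.β * S.Q4 u u z w

/-- the `a_u`-norm -/
noncomputable def aunorm (u z : H) : ℝ := Real.sqrt (S.auinner u z z)

/-- the Riemannian `a_u`-gradient
`∇^R_{a_u}E(u) = u − G_{a_u}u / ‖G_{a_u}u‖²_{a_u}` -/
noncomputable def gradRAu (u : H) : H :=
  u - ((S.aunorm u (S.Gau u u)) ^ 2)⁻¹ • S.Gau u u

/-- `ustar` is the ground state: the minimizer of `E` over `M`. -/
def IsGroundState (ustar : H) : Prop :=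
  ustar ∈ S.Msphere ∧ ∀ u ∈ S.Msphere, S.energy ustar ≤ S.energy u

/-- `lam0` and `lam1` are the smallest and second smallest eigenvalues of the
linearized problem `(−Δ + V + β|u*|²)u = λu` at the ground state `u*` (whose
bilinear form is the `a_{u*}`-inner product): `u*` is an eigenfunction for
`lam0`, `lam0` is a lower bound for the Rayleigh quotient, and `lam1` is a lower
bound for the Rayleigh quotient on the `L²`-orthogonal complement of `u*`. -/
def LinearizedEigs (ustar : H) (lam0 lam1 : ℝ) : Prop :=
  (∀ z : H, S.auinner ustar z ustar = lam0 * S.P z ustar) ∧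
  (∀ z : H, lam0 * S.P z z ≤ S.auinner ustar z z) ∧
  (∀ z : H, S.P z ustar = 0 → lam1 * S.P z z ≤ S.auinner ustar z z)

end GPSetting

/-- A symmetric positive semidefinite bilinear form whose quadratic form is bounded by
`K ‖·‖²` is bounded by `K`. -/
lemma LinearMap.abs_apply_le_of_quadratic_le {H : Type*} [NormedAddCommGroup H]
    [InnerProductSpace ℝ H] (B : H →ₗ[ℝ] H →ₗ[ℝ] ℝ) (hs : ∀ z w, B z w = B w z)
    (hn : ∀ z, 0 ≤ B z z) {K : ℝ} (hK : ∀ z, B z z ≤ K * ‖z‖ ^ 2) (a b : H) :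
    |B a b| ≤ K * ‖a‖ * ‖b‖ := by
  have hcs : (B a b) ^ 2 ≤ B a a * B b b :=
    LinearMap.BilinForm.apply_sq_le_of_symm B hn ⟨fun x y => by simp [hs x y]⟩ a b
  rcases eq_or_ne a 0 with rfl | ha
  · simp
  have hna : 0 < ‖a‖ ^ 2 := by positivity
  have hK0 : 0 ≤ K := by
    by_contra hc
    nlinarith [hn a, hK a]
  apply abs_le_of_sq_le_sq _ (by positivity)
  calc (B a b) ^ 2 ≤ B a a * B b b := hcs
    _ ≤ (K * ‖a‖ ^ 2) * (K * ‖b‖ ^ 2) :=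
        mul_le_mul (hK a) (hK b) (hn b) (by positivity)
    _ = (K * ‖a‖ * ‖b‖) ^ 2 := by ring

lemma norm_le_of_forall_inner_le {H : Type*} [NormedAddCommGroup H] [InnerProductSpace ℝ H]
    {x : H} {k : ℝ} (hk : 0 ≤ k) (h : ∀ z : H, ⟪z, x⟫ ≤ k * ‖z‖) : ‖x‖ ≤ k := by
  have hx := h x
  rw [real_inner_self_eq_norm_sq] at hx
  rcases (norm_nonneg x).eq_or_lt with h0 | h0
  · rwa [← h0]
  · nlinarith

namespace GPSetting

variable {H : Type*} [NormedAddCommGroup H] [InnerProductSpace ℝ H] (S : GPSetting H)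

lemma abs_P_le (a b : H) : |S.P a b| ≤ S.C₃ ^ 2 * ‖a‖ * ‖b‖ :=
  LinearMap.abs_apply_le_of_quadratic_le S.P S.P_symm S.P_nonneg S.poincare a b

lemma abs_Vf_le (a b : H) : |S.Vf a b| ≤ S.Vmax * S.C₃ ^ 2 * ‖a‖ * ‖b‖ := by
  refine LinearMap.abs_apply_le_of_quadratic_le S.Vf S.Vf_symm S.Vf_nonneg (fun z => ?_) a b
  rw [mul_assoc]
  exact (S.Vf_le z).trans (mul_le_mul_of_nonneg_left (S.poincare z) S.Vmax_nonneg)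

lemma Q4_smul_sq (s : ℝ) (a w : H) : S.Q4 a a (s • w) (s • w) = s ^ 2 * S.Q4 a a w w := by
  simp only [map_smul, LinearMap.smul_apply, smul_eq_mul]
  ring

lemma Q4_swap (a w : H) : S.Q4 a a w w = S.Q4 w w a a := by
  rw [S.Q4_symm₂ a a w w, S.Q4_symm₁ a w a w, S.Q4_symm₃ w a a w, S.Q4_symm₂ w a w a]

lemma Q4_sum_diff (a w : H) :
    S.Q4 (a + w) (a + w) (a + w) (a + w) + S.Q4 (a - w) (a - w) (a - w) (a - w)
      = 2 * S.Q4 a a a a + 12 * S.Q4 a a w w + 2 * S.Q4 w w w w := by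
  have hneg : S.Q4 (-w) = (-1 : ℝ) • S.Q4 w := by rw [← neg_one_smul ℝ w, map_smul]
  simp only [sub_eq_add_neg, map_add, LinearMap.add_apply, map_neg, hneg, LinearMap.neg_apply,
    LinearMap.smul_apply, smul_eq_mul]
  have h1 := S.Q4_symm₂ a a w w
  have h2 := S.Q4_symm₃ a w a w
  have h3 := S.Q4_symm₁ a w a w
  have h4 := S.Q4_symm₁ a w w a
  have h5 := S.Q4_swap a w
  linarith

lemma Q4_sq_le (a w : H) : S.Q4 a a w w ≤ 3 * S.C₁ ^ 4 * ‖a‖ ^ 2 * ‖w‖ ^ 2 := by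
  have unit : ∀ x y : H, ‖x‖ = 1 → ‖y‖ = 1 → S.Q4 x x y y ≤ 3 * S.C₁ ^ 4 := by
    intro x y hx hy
    have hC : 0 < S.C₁ ^ 4 := pow_pos S.C₁_pos 4
    have hadd : ‖x + y‖ ^ 4 ≤ 2 ^ 4 := by
      gcongr
      exact (norm_add_le x y).trans (by linarith)
    have hsub : ‖x - y‖ ^ 4 ≤ 2 ^ 4 := by
      gcongr
      exact (norm_sub_le x y).trans (by linarith)
    have e1 := (S.embed_L4 (x + y)).trans (mul_le_mul_of_nonneg_left hadd hC.le)
    have e2 := (S.embed_L4 (x - y)).trans (mul_le_mul_of_nonneg_left hsub hC.le)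
    have := S.Q4_sum_diff x y
    have := S.Q4_sq_nonneg x x
    have := S.Q4_sq_nonneg y y
    linarith
  rcases eq_or_ne a 0 with rfl | ha
  · simp
  rcases eq_or_ne w 0 with rfl | hw
  · simp
  have ha' : ‖a‖ ≠ 0 := norm_ne_zero_iff.mpr ha
  have hw' : ‖w‖ ≠ 0 := norm_ne_zero_iff.mpr hw
  have h := unit (‖a‖⁻¹ • a) (‖w‖⁻¹ • w) (by simp [norm_smul, ha']) (by simp [norm_smul, hw'])
  rw [Q4_smul_sq, Q4_swap, Q4_smul_sq, Q4_swap] at h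
  have hp : 0 ≤ ‖a‖ ^ 2 * ‖w‖ ^ 2 := by positivity
  calc S.Q4 a a w w
      = (‖w‖⁻¹ ^ 2 * (‖a‖⁻¹ ^ 2 * S.Q4 a a w w)) * (‖a‖ ^ 2 * ‖w‖ ^ 2) := by field_simp
    _ ≤ 3 * S.C₁ ^ 4 * (‖a‖ ^ 2 * ‖w‖ ^ 2) := mul_le_mul_of_nonneg_right h hp
    _ = _ := by ring

lemma abs_Q4_le (w a b : H) :
    |S.Q4 w w a b| ≤ 3 * S.C₁ ^ 4 * ‖w‖ ^ 2 * ‖a‖ * ‖b‖ :=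
  LinearMap.abs_apply_le_of_quadratic_le (S.Q4 w w) (S.Q4_symm₃ w w) (S.Q4_sq_nonneg w)
    (S.Q4_sq_le w) a b

lemma norm_G_le (e : H) : ‖S.G e‖ ≤ S.C₃ ^ 2 * ‖e‖ := by
  refine norm_le_of_forall_inner_le (by positivity) fun z => ?_
  rw [S.G_def]
  linarith [(abs_le.mp (S.abs_P_le z e)).2]

lemma norm_GV_le (e : H) : ‖S.GV e‖ ≤ S.Vmax * S.C₃ ^ 2 * ‖e‖ := by
  have := S.Vmax_nonneg
  refine norm_le_of_forall_inner_le (by positivity) fun z => ?_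
  rw [S.GV_def]
  linarith [(abs_le.mp (S.abs_Vf_le z e)).2]

lemma Q4_cube_expand (z w e : H) :
    S.Q4 z (w + e) (w + e) (w + e)
      = S.Q4 z w w w + 3 * S.Q4 w w z e + 3 * S.Q4 e e z w + S.Q4 e e z e := by
  have p : ∀ a b c : H, S.Q4 z a b c = S.Q4 a b z c := fun a b c => by
    rw [S.Q4_symm₁ z a b c, S.Q4_symm₂ a z b c]
  have q : ∀ a b c : H, S.Q4 a b z c = S.Q4 a c z b := fun a b c => by
    rw [← p, S.Q4_symm₃ z a b c, p]
  have r : ∀ a b c : H, S.Q4 a b z c = S.Q4 b a z c := fun a b c => S.Q4_symm₁ a b z c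
  simp only [map_add, LinearMap.add_apply, p]
  have h1 := q w e w
  have h2 := r e w w
  have h3 := q e w e
  have h4 := r w e e
  linarith

lemma norm_Gc_sub_le {w e : H} {B : ℝ} (hw : ‖w‖ ≤ B) (he : ‖e‖ ≤ 1) :
    ‖S.Gc (w + e) - S.Gc w‖ ≤ 3 * S.C₁ ^ 4 * (3 * B ^ 2 + 3 * B + 1) * ‖e‖ := by
  have hC : 0 < S.C₁ ^ 4 := pow_pos S.C₁_pos 4
  have hB : 0 ≤ B := (norm_nonneg w).trans hw
  refine norm_le_of_forall_inner_le (by positivity) fun z => ?_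
  rw [inner_sub_right, S.Gc_def, S.Gc_def, Q4_cube_expand]
  have h1 := (abs_le.mp (S.abs_Q4_le w z e)).2
  have h2 := (abs_le.mp (S.abs_Q4_le e z w)).2
  have h3 := (abs_le.mp (S.abs_Q4_le e z e)).2
  have k1 : 3 * S.C₁ ^ 4 * ‖w‖ ^ 2 * ‖z‖ * ‖e‖ ≤ 3 * S.C₁ ^ 4 * B ^ 2 * ‖z‖ * ‖e‖ := by gcongr
  have e2 : ‖e‖ ^ 2 ≤ ‖e‖ := by nlinarith [norm_nonneg e]
  have k2 : 3 * S.C₁ ^ 4 * ‖e‖ ^ 2 * ‖z‖ * ‖w‖ ≤ 3 * S.C₁ ^ 4 * ‖e‖ * ‖z‖ * B := by gcongr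
  have k3 : 3 * S.C₁ ^ 4 * ‖e‖ ^ 2 * ‖z‖ * ‖e‖ ≤ 3 * S.C₁ ^ 4 * ‖e‖ * ‖z‖ * 1 := by gcongr
  linarith

lemma inner_gradH1 (z u : H) : ⟪z, S.gradH1 u⟫ = S.auinner u z u := by
  have h : S.Q4 z u u u = S.Q4 u u z u := by rw [S.Q4_symm₁ z u u u, S.Q4_symm₂ u z u u]
  simp only [gradH1, auinner, inner_add_right, inner_smul_right, S.GV_def, S.Gc_def, h]

lemma gradH1_eq_of_linearizedEigs {ustar : H} {lam0 lam1 : ℝ}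
    (heig : S.LinearizedEigs ustar lam0 lam1) : S.gradH1 ustar = lam0 • S.G ustar := by
  refine ext_inner_left ℝ fun z => ?_
  rw [inner_gradH1, inner_smul_right, S.G_def, heig.1]

/-- Lipschitz bound for the residual `∇_{H¹}E(u) − λ₀ G_{H¹}u` near an eigenfunction. -/
lemma norm_residual_le {w e : H} {lam B : ℝ} (hlam : 0 ≤ lam)
    (hgrad : S.gradH1 w = lam • S.G w) (hw : ‖w‖ ≤ B) (he : ‖e‖ ≤ 1) :
    ‖S.gradH1 (w + e) - lam • S.G (w + e)‖ ≤
      (1 + S.Vmax * S.C₃ ^ 2 + S.β * (3 * S.C₁ ^ 4 * (3 * B ^ 2 + 3 * B + 1))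
        + lam * S.C₃ ^ 2) * ‖e‖ := by
  have hβ := S.β_nonneg
  have heq : S.gradH1 (w + e) - lam • S.G (w + e)
      = e + S.GV e + S.β • (S.Gc (w + e) - S.Gc w) - lam • S.G e := by
    have : S.gradH1 (w + e) - lam • S.G (w + e)
        = (S.gradH1 (w + e) - S.gradH1 w) - lam • S.G e := by
      rw [hgrad, map_add, smul_add]
      abel
    rw [this, gradH1, gradH1, map_add, smul_sub]
    abel
  rw [heq]
  have n1 : ‖S.β • (S.Gc (w + e) - S.Gc w)‖
      ≤ S.β * (3 * S.C₁ ^ 4 * (3 * B ^ 2 + 3 * B + 1) * ‖e‖) := by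
    rw [norm_smul, Real.norm_of_nonneg hβ]
    exact mul_le_mul_of_nonneg_left (S.norm_Gc_sub_le hw he) hβ
  have n2 : ‖lam • S.G e‖ ≤ lam * (S.C₃ ^ 2 * ‖e‖) := by
    rw [norm_smul, Real.norm_of_nonneg hlam]
    exact mul_le_mul_of_nonneg_left (S.norm_G_le e) hlam
  have n3 := S.norm_GV_le e
  have t1 := norm_sub_le (e + S.GV e + S.β • (S.Gc (w + e) - S.Gc w)) (lam • S.G e)
  have t2 := norm_add_le (e + S.GV e) (S.β • (S.Gc (w + e) - S.Gc w))
  have t3 := norm_add_le e (S.GV e)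
  linarith

lemma P_G_self (u : H) : S.P (S.G u) u = ‖S.G u‖ ^ 2 := by
  rw [← S.G_def, real_inner_self_eq_norm_sq]

lemma one_le_norm_mul_norm_G {u : H} (hu : S.P u u = 1) : 1 ≤ ‖u‖ * ‖S.G u‖ := by
  have := real_inner_le_norm u (S.G u)
  rwa [S.G_def, hu] at this

lemma norm_G_pos {u : H} (hu : S.P u u = 1) : 0 < ‖S.G u‖ := by
  have := S.one_le_norm_mul_norm_G hu
  by_contra hc
  nlinarith [norm_nonneg u, norm_nonneg (S.G u)]

lemma P_gradRH1_self {u : H} (hu : S.P u u = 1) : S.P (S.gradRH1 u) u = 0 := by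
  have := (S.norm_G_pos hu).ne'
  simp only [gradRH1, map_sub, map_smul, LinearMap.sub_apply, LinearMap.smul_apply, smul_eq_mul,
    P_G_self]
  field_simp
  ring

/-- The Lagrange multiplier of the Riemannian gradient differs from `lam` by at most a multiple
of the residual `∇_{H¹}E(u) − lam G_{H¹}u`. -/
lemma abs_multiplier_sub_le {u : H} {lam B : ℝ} (hu : S.P u u = 1) (huB : ‖u‖ ≤ B) :
    |S.P (S.gradH1 u) u / ‖S.G u‖ ^ 2 - lam| ≤
      S.C₃ ^ 2 * B ^ 3 * ‖S.gradH1 u - lam • S.G u‖ := by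
  have hG := S.norm_G_pos hu
  have hB : 0 ≤ B := (norm_nonneg u).trans huB
  have h1 : 1 ≤ B * ‖S.G u‖ :=
    (S.one_le_norm_mul_norm_G hu).trans (mul_le_mul_of_nonneg_right huB hG.le)
  have hm : S.P (S.gradH1 u) u / ‖S.G u‖ ^ 2 - lam
      = S.P (S.gradH1 u - lam • S.G u) u / ‖S.G u‖ ^ 2 := by
    simp only [map_sub, map_smul, LinearMap.sub_apply, LinearMap.smul_apply, smul_eq_mul, P_G_self]
    field_simp
  rw [hm, abs_div, abs_of_pos (pow_pos hG 2), div_le_iff₀ (pow_pos hG 2)]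
  calc |S.P (S.gradH1 u - lam • S.G u) u|
      ≤ S.C₃ ^ 2 * ‖S.gradH1 u - lam • S.G u‖ * ‖u‖ := S.abs_P_le _ _
    _ ≤ S.C₃ ^ 2 * ‖S.gradH1 u - lam • S.G u‖ * B * 1 ^ 2 := by
        rw [one_pow, mul_one]
        gcongr
    _ ≤ S.C₃ ^ 2 * ‖S.gradH1 u - lam • S.G u‖ * B * (B * ‖S.G u‖) ^ 2 := by gcongr
    _ = _ := by ring

lemma norm_gradRH1_le {u : H} {lam B : ℝ} (hu : S.P u u = 1) (huB : ‖u‖ ≤ B) :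
    ‖S.gradRH1 u‖ ≤ (1 + S.C₃ ^ 4 * B ^ 4) * ‖S.gradH1 u - lam • S.G u‖ := by
  have hB : 0 ≤ B := (norm_nonneg u).trans huB
  have heq : S.gradRH1 u = (S.gradH1 u - lam • S.G u)
      - (S.P (S.gradH1 u) u / ‖S.G u‖ ^ 2 - lam) • S.G u := by
    rw [gradRH1, sub_smul]
    abel
  have hGB : ‖S.G u‖ ≤ S.C₃ ^ 2 * B :=
    (S.norm_G_le u).trans (mul_le_mul_of_nonneg_left huB (by positivity))
  calc ‖S.gradRH1 u‖
      ≤ ‖S.gradH1 u - lam • S.G u‖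
        + |S.P (S.gradH1 u) u / ‖S.G u‖ ^ 2 - lam| * ‖S.G u‖ := by
        rw [heq, ← Real.norm_eq_abs, ← norm_smul]
        exact norm_sub_le _ _
    _ ≤ ‖S.gradH1 u - lam • S.G u‖
        + (S.C₃ ^ 2 * B ^ 3 * ‖S.gradH1 u - lam • S.G u‖) * (S.C₃ ^ 2 * B) := by
        gcongr
        exact S.abs_multiplier_sub_le hu huB
    _ = _ := by ring

/-- Coercivity of `a_{u*} − λ₀` along displacements between points of the `L²` sphere. -/
lemma coercive_of_linearizedEigs {w e : H} {lam0 lam1 : ℝ}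
    (heig : S.LinearizedEigs w lam0 lam1) (hlam0 : 0 < lam0) (hgap : lam0 < lam1)
    (hw : S.P w w = 1) (hwe : S.P e w = -(S.P e e / 2)) :
    (1 - lam0 / lam1) * ‖e‖ ^ 2 - lam0 * (S.P e e / 2) ^ 2
      ≤ S.auinner w e e - lam0 * S.P e e := by
  have hlam1 : 0 < lam1 := hlam0.trans hgap
  have hq : lam0 / lam1 < 1 := (div_lt_one hlam1).mpr hgap
  have hq0 : 0 < lam0 / lam1 := div_pos hlam0 hlam1
  set s := S.P e w with hs
  have hPwe : S.P w e = s := S.P_symm w e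
  have hself : S.auinner w e w = lam0 * s := heig.1 e
  have hww : S.auinner w w w = lam0 := by rw [heig.1, hw, mul_one]
  have horth : S.P (e - s • w) w = 0 := by
    simp [hw, ← hs]
  have hP : S.P (e - s • w) (e - s • w) = S.P e e - s ^ 2 := by
    simp only [map_sub, map_smul, LinearMap.sub_apply, LinearMap.smul_apply, smul_eq_mul, hw,
      hPwe, ← hs]
    ring
  have hA : S.auinner w (e - s • w) (e - s • w) = S.auinner w e e - lam0 * s ^ 2 := by
    have hsymm : S.auinner w w e = S.auinner w e w := by
      simp only [auinner, real_inner_comm, S.Vf_symm e w, S.Q4_symm₃ w w e w]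
    have hexp : S.auinner w (e - s • w) (e - s • w)
        = S.auinner w e e - s * S.auinner w e w - s * S.auinner w w e
          + s ^ 2 * S.auinner w w w := by
      simp only [auinner, map_sub, map_smul, LinearMap.sub_apply, LinearMap.smul_apply,
        smul_eq_mul, inner_sub_left, inner_sub_right, inner_smul_left, inner_smul_right,
        RCLike.conj_to_real]
      ring
    rw [hexp, hsymm, hself, hww]
    ring
  have h1 := heig.2.2 _ horth
  rw [hP, hA] at h1
  have h2 : lam0 * (S.P e e - s ^ 2) ≤ lam0 / lam1 * (S.auinner w e e - lam0 * s ^ 2) := by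
    calc lam0 * (S.P e e - s ^ 2) = lam0 / lam1 * (lam1 * (S.P e e - s ^ 2)) := by field_simp
      _ ≤ _ := mul_le_mul_of_nonneg_left h1 hq0.le
  have h3 : ‖e‖ ^ 2 ≤ S.auinner w e e := by
    simp only [auinner, real_inner_self_eq_norm_sq]
    nlinarith [S.Vf_nonneg e, mul_nonneg S.β_nonneg (S.Q4_sq_nonneg w e)]
  have h4 : (1 - lam0 / lam1) * ‖e‖ ^ 2 ≤ (1 - lam0 / lam1) * S.auinner w e e :=
    mul_le_mul_of_nonneg_left h3 (by linarith)
  have h5 : s ^ 2 = (S.P e e / 2) ^ 2 := by rw [hwe]; ring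
  rw [← h5]
  nlinarith [mul_nonneg (mul_nonneg hq0.le hlam0.le) (sq_nonneg s)]

/-- The part of `a_u(u, e)` not seen by the linearized form is nonnegative up to cubic terms. -/
lemma auinner_add_ge {w e : H} {lam B : ℝ} (heig : ∀ z, S.auinner w z w = lam * S.P z w)
    (hw : ‖w‖ ≤ B) :
    S.auinner w e e + lam * S.P e w - S.β * (9 * S.C₁ ^ 4 * B) * ‖e‖ ^ 3
      ≤ S.auinner (w + e) e (w + e) := by
  have hβ := S.β_nonneg
  have hC : 0 < S.C₁ ^ 4 := pow_pos S.C₁_pos 4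
  have hQ : S.Q4 (w + e) (w + e) e (w + e)
      = S.Q4 w w e w + 3 * S.Q4 w w e e + 3 * S.Q4 e e e w + S.Q4 e e e e := by
    have h := S.Q4_cube_expand e w e
    have p : ∀ a b : H, S.Q4 e a a b = S.Q4 a a e b := fun a b => by
      rw [S.Q4_symm₁ e a a b, S.Q4_symm₂ a e a b]
    rwa [p, p] at h
  have hexp : S.auinner (w + e) e (w + e) = S.auinner w e e + S.auinner w e w
      + S.β * (2 * S.Q4 w w e e + 3 * S.Q4 e e e w + S.Q4 e e e e) := by
    simp only [auinner, hQ]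
    simp only [inner_add_right, map_add]
    ring
  rw [hexp, heig e]
  have h1 := (abs_le.mp (S.abs_Q4_le e e w)).1
  have h2 : 3 * S.C₁ ^ 4 * ‖e‖ ^ 2 * ‖e‖ * ‖w‖ ≤ 3 * S.C₁ ^ 4 * ‖e‖ ^ 2 * ‖e‖ * B := by gcongr
  have h3 : -(9 * S.C₁ ^ 4 * B * ‖e‖ ^ 3)
      ≤ 2 * S.Q4 w w e e + 3 * S.Q4 e e e w + S.Q4 e e e e := by
    linarith [S.Q4_sq_nonneg w e, S.Q4_sq_nonneg e e]
  linarith [mul_le_mul_of_nonneg_left h3 hβ]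

/-- Linear growth and local coercivity of the Riemannian gradient near the ground state. -/
lemma exists_gradRH1_bounds {w : H} {lam0 lam1 : ℝ} (hw : S.P w w = 1)
    (heig : S.LinearizedEigs w lam0 lam1) (hlam0 : 0 < lam0) (hgap : lam0 < lam1) :
    ∃ L c δ : ℝ, 0 < L ∧ 0 < c ∧ c < 1 ∧ 0 < δ ∧ δ ≤ 1 ∧
      ∀ u : H, S.P u u = 1 → ‖u - w‖ ≤ δ →
        ‖S.gradRH1 u‖ ≤ L * ‖u - w‖ ∧ c * ‖u - w‖ ^ 2 ≤ ⟪S.gradRH1 u, u - w⟫ := by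
  have hβ := S.β_nonneg
  have hV := S.Vmax_nonneg
  have hC1 : 0 < S.C₁ ^ 4 := pow_pos S.C₁_pos 4
  have hlam1 : 0 < lam1 := hlam0.trans hgap
  have hq : lam0 / lam1 < 1 := (div_lt_one hlam1).mpr hgap
  have hq0 : 0 < lam0 / lam1 := div_pos hlam0 hlam1
  obtain ⟨B, hBdef⟩ : ∃ B, B = ‖w‖ + 1 := ⟨_, rfl⟩
  have hB : 0 < B := by rw [hBdef]; positivity
  obtain ⟨L₀, hL₀def⟩ : ∃ L₀, L₀ = 1 + S.Vmax * S.C₃ ^ 2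
      + S.β * (3 * S.C₁ ^ 4 * (3 * B ^ 2 + 3 * B + 1)) + lam0 * S.C₃ ^ 2 := ⟨_, rfl⟩
  have hL₀ : 0 < L₀ := by rw [hL₀def]; positivity
  -- bound of all cubic error terms
  obtain ⟨K, hKdef⟩ : ∃ K, K = S.β * (9 * S.C₁ ^ 4 * B) + S.C₃ ^ 4 * B ^ 3 * L₀
      + lam0 * S.C₃ ^ 4 + 1 := ⟨_, rfl⟩
  have hK : 0 < K := by rw [hKdef]; positivity
  have hc : 0 < 1 - lam0 / lam1 := by linarith
  refine ⟨(1 + S.C₃ ^ 4 * B ^ 4) * L₀, (1 - lam0 / lam1) / 2,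
    min 1 ((1 - lam0 / lam1) / (2 * K)), by positivity, by linarith, by linarith,
    by positivity, min_le_left _ _, fun u hu hd => ?_⟩
  obtain ⟨e, he⟩ : ∃ e, u = w + e := ⟨u - w, by abel⟩
  have hue : u - w = e := by rw [he]; abel
  rw [hue] at hd ⊢
  have hd1 : ‖e‖ ≤ 1 := hd.trans (min_le_left _ _)
  have hdK : K * ‖e‖ ≤ (1 - lam0 / lam1) / 2 := by
    have := hd.trans (min_le_right _ _)
    rw [le_div_iff₀ (by positivity)] at this
    linarith
  have hwB : ‖w‖ ≤ B := by linarith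
  have huB : ‖u‖ ≤ B := by
    rw [he, hBdef]
    exact (norm_add_le w e).trans (by linarith)
  have hres : ‖S.gradH1 u - lam0 • S.G u‖ ≤ L₀ * ‖e‖ := by
    rw [he, hL₀def]
    exact S.norm_residual_le hlam0.le (S.gradH1_eq_of_linearizedEigs heig) hwB hd1
  refine ⟨?_, ?_⟩
  · calc ‖S.gradRH1 u‖ ≤ (1 + S.C₃ ^ 4 * B ^ 4) * ‖S.gradH1 u - lam0 • S.G u‖ :=
          S.norm_gradRH1_le hu huB
      _ ≤ (1 + S.C₃ ^ 4 * B ^ 4) * (L₀ * ‖e‖) := by gcongr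
      _ = _ := by ring
  · have hexp : S.P w w + 2 * S.P e w + S.P e e = 1 := by
      rw [← hu, he]
      simp only [map_add, LinearMap.add_apply, S.P_symm w e]
      ring
    have hwe : S.P e w = -(S.P e e / 2) := by linarith
    have hPeu : S.P e u = S.P e e / 2 := by
      rw [he, map_add]
      linarith
    obtain ⟨μ, hμ⟩ : ∃ μ, μ = S.P (S.gradH1 u) u / ‖S.G u‖ ^ 2 := ⟨_, rfl⟩
    have hinner : ⟪S.gradRH1 u, e⟫ = S.auinner u e u - μ * (S.P e e / 2) := by
      rw [real_inner_comm, gradRH1, ← hμ, inner_sub_right, inner_smul_right, inner_gradH1,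
        S.G_def, hPeu]
    have h1 := S.coercive_of_linearizedEigs heig hlam0 hgap hw hwe
    have h2 := S.auinner_add_ge heig.1 hwB (e := e)
    rw [← he, hwe] at h2
    have hp0 := S.P_nonneg e
    have hp := S.poincare e
    have hμ' : μ - lam0 ≤ S.C₃ ^ 2 * B ^ 3 * (L₀ * ‖e‖) := by
      rw [hμ]
      refine (le_abs_self _).trans ((S.abs_multiplier_sub_le hu huB).trans ?_)
      gcongr
    have h3 : (μ - lam0) * (S.P e e / 2) ≤ S.C₃ ^ 4 * B ^ 3 * L₀ * ‖e‖ ^ 3 := by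
      calc (μ - lam0) * (S.P e e / 2)
          ≤ S.C₃ ^ 2 * B ^ 3 * (L₀ * ‖e‖) * (S.P e e / 2) :=
            mul_le_mul_of_nonneg_right hμ' (by linarith)
        _ ≤ S.C₃ ^ 2 * B ^ 3 * (L₀ * ‖e‖) * (S.C₃ ^ 2 * ‖e‖ ^ 2) := by
            gcongr
            linarith
        _ = _ := by ring
    have h4 : lam0 * (S.P e e / 2) ^ 2 ≤ lam0 * S.C₃ ^ 4 * ‖e‖ ^ 3 := by
      calc lam0 * (S.P e e / 2) ^ 2 ≤ lam0 * (S.C₃ ^ 2 * ‖e‖ ^ 2) ^ 2 := by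
            gcongr
            linarith
        _ = lam0 * S.C₃ ^ 4 * ‖e‖ ^ 3 * ‖e‖ := by ring
        _ ≤ lam0 * S.C₃ ^ 4 * ‖e‖ ^ 3 * 1 := by gcongr
        _ = _ := mul_one _
    have h5 : K * ‖e‖ ^ 3 ≤ (1 - lam0 / lam1) / 2 * ‖e‖ ^ 2 := by
      calc K * ‖e‖ ^ 3 = K * ‖e‖ * ‖e‖ ^ 2 := by ring
        _ ≤ _ := by gcongr
    have h6 : 0 ≤ ‖e‖ ^ 3 := by positivity
    rw [hKdef] at h5
    rw [hinner]
    nlinarith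

lemma P_retract_self {v : H} (hv : 0 < S.P v v) : S.P (S.retract v) (S.retract v) = 1 := by
  have hs : S.l2norm v ^ 2 = S.P v v := Real.sq_sqrt hv.le
  have hpos : 0 < S.l2norm v := Real.sqrt_pos.mpr hv
  simp only [retract, map_smul, LinearMap.smul_apply, smul_eq_mul, ← hs]
  field_simp

lemma norm_retract_sub_le {v : H} {x : ℝ} (hx : 0 ≤ x) (hv : S.P v v = 1 + x) :
    ‖S.retract v - v‖ ≤ x * ‖v‖ := by
  have hs : S.l2norm v ^ 2 = 1 + x := by
    rw [← hv]
    exact Real.sq_sqrt (S.P_nonneg v)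
  have h1 : 1 ≤ S.l2norm v := by
    have : 0 ≤ S.l2norm v := Real.sqrt_nonneg _
    nlinarith
  have hi : (S.l2norm v)⁻¹ ≤ 1 := inv_le_one_of_one_le₀ h1
  have hlow : 1 - x ≤ (S.l2norm v)⁻¹ := by
    rw [← one_div, le_div_iff₀ (by linarith)]
    nlinarith
  have heq : S.retract v - v = ((S.l2norm v)⁻¹ - 1) • v := by rw [retract, sub_smul, one_smul]
  rw [heq, norm_smul, Real.norm_eq_abs]
  gcongr
  rw [abs_le]
  constructor <;> linarith

/-- One step of the `H¹`-scheme stays on the sphere and is a contraction towards `w`, given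
linear growth and coercivity of the Riemannian gradient at the current iterate. -/
lemma step_contraction {w u : H} {L c t : ℝ} (hL : 0 < L) (hu : S.P u u = 1)
    (hd : ‖u - w‖ ≤ 1) (hg : ‖S.gradRH1 u‖ ≤ L * ‖u - w‖)
    (hc : c * ‖u - w‖ ^ 2 ≤ ⟪S.gradRH1 u, u - w⟫) (hc1 : c < 1) (ht : 0 < t) (ht1 : t ≤ 1)
    (htK : t * (L ^ 2 / 2 + S.C₃ ^ 2 * L ^ 2 * (‖w‖ + 1 + L)) ≤ c / 2) :
    S.P (S.retract (u - t • S.gradRH1 u)) (S.retract (u - t • S.gradRH1 u)) = 1 ∧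
      ‖S.retract (u - t • S.gradRH1 u) - w‖ ≤ (1 - t * c / 2) * ‖u - w‖ := by
  set g := S.gradRH1 u with hgdef
  set v := u - t • g with hvdef
  obtain ⟨ε, hε⟩ : ∃ ε, ε = ‖u - w‖ := ⟨_, rfl⟩
  rw [← hε] at hd hg hc ⊢
  have hε0 : 0 ≤ ε := by rw [hε]; positivity
  have hPv : S.P v v = 1 + t ^ 2 * S.P g g := by
    have h0 : S.P g u = 0 := S.P_gradRH1_self hu
    have h0' : S.P u g = 0 := by rw [S.P_symm, h0]
    simp only [hvdef, map_sub, map_smul, LinearMap.sub_apply, LinearMap.smul_apply, smul_eq_mul,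
      hu, h0, h0']
    ring
  have hx : 0 ≤ t ^ 2 * S.P g g := mul_nonneg (sq_nonneg t) (S.P_nonneg g)
  refine ⟨S.P_retract_self (by linarith), ?_⟩
  have hg2 : ‖g‖ ^ 2 ≤ L ^ 2 * ε ^ 2 := by
    rw [← mul_pow]
    gcongr
  have hvw : ‖v - w‖ ≤ (1 - t * c + t ^ 2 * L ^ 2 / 2) * ε := by
    have htc : 0 ≤ 1 - t * c := by nlinarith
    refine abs_le_of_sq_le_sq' ?_ (by positivity) |>.2
    have heq : v - w = (u - w) - t • g := by rw [hvdef]; abel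
    have hsq : ‖v - w‖ ^ 2 = ε ^ 2 - 2 * (t * ⟪g, u - w⟫) + t ^ 2 * ‖g‖ ^ 2 := by
      rw [heq, norm_sub_sq_real, inner_smul_right, norm_smul, mul_pow, real_inner_comm, hε,
        Real.norm_eq_abs, sq_abs]
    have h1 : t * (c * ε ^ 2) ≤ t * ⟪g, u - w⟫ := mul_le_mul_of_nonneg_left hc ht.le
    have h2 : t ^ 2 * ‖g‖ ^ 2 ≤ t ^ 2 * (L ^ 2 * ε ^ 2) :=
      mul_le_mul_of_nonneg_left hg2 (sq_nonneg t)
    have h3 : 0 ≤ (-(t * c) + t ^ 2 * L ^ 2 / 2) ^ 2 * ε ^ 2 := by positivity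
    rw [hsq]
    linarith
  have hnv : ‖v‖ ≤ ‖w‖ + 1 + L := by
    have h1 : ‖v‖ ≤ ‖u‖ + t * ‖g‖ := by
      have := norm_sub_le u (t • g)
      rwa [norm_smul, Real.norm_of_nonneg ht.le] at this
    have h2 : ‖u‖ ≤ ‖w‖ + ε := by
      rw [hε]
      linarith [norm_sub_norm_le u w]
    have h3 : t * ‖g‖ ≤ 1 * (L * 1) := by
      gcongr
      exact hg.trans (by gcongr)
    linarith
  have hr : ‖S.retract v - v‖ ≤ t ^ 2 * (S.C₃ ^ 2 * L ^ 2 * (‖w‖ + 1 + L)) * ε := by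
    calc ‖S.retract v - v‖ ≤ t ^ 2 * S.P g g * ‖v‖ := S.norm_retract_sub_le hx hPv
      _ ≤ t ^ 2 * (S.C₃ ^ 2 * (L ^ 2 * ε)) * (‖w‖ + 1 + L) := by
          gcongr
          refine (S.poincare g).trans ?_
          gcongr
          refine hg2.trans ?_
          gcongr
          nlinarith
      _ = _ := by ring
  have htri : ‖S.retract v - w‖ ≤ ‖S.retract v - v‖ + ‖v - w‖ :=
    norm_sub_le_norm_sub_add_norm_sub _ _ _
  have hfin := mul_le_mul_of_nonneg_right htK (mul_nonneg ht.le hε0)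
  linarith

end GPSetting

/-- **Local exponential convergence for the `H¹`-scheme**
(Theorem `thm:local_conv_H1`).  Assume the hypotheses of the energy-decay
theorem for the `H¹`-scheme and the eigengap assumption `λ₁ > λ₀` for the
linearized problem at the ground state `u*`.  Then there are constants `Cα`
(the energy-decay stepsize threshold) and `Lg > 0` (depending only on
`Ω, d, β, V, u*` and `r = ‖u₀‖_{H¹₀}`) such that whenever the stepsizes satisfy
`0 < αmin ≤ αₙ ≤ αmax ≤ Cα` and
`1 + Lg²αmax² − αmax·min{1, (λ₁−λ₀)/(4λ₀)} < 1`, the `H¹`-scheme iterates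
starting from any `u₀ ∈ M` close enough to `u*` converge exponentially to `u*`
in `H¹₀(Ω)`: there is `C_δ ∈ (0,1)` with
`‖u_{n+1} − u*‖_{H¹₀} ≤ C_δ ‖u_n − u*‖_{H¹₀}` for all `n`. -/
theorem local_conv_H1
    {H : Type*} [NormedAddCommGroup H] [InnerProductSpace ℝ H]
    (S : GPSetting H) (ustar : H) (lam0 lam1 : ℝ)
    (hgs : S.IsGroundState ustar)
    (heig : S.LinearizedEigs ustar lam0 lam1)
    (hlam0 : 0 < lam0) (hgap : lam0 < lam1) (r : ℝ) :
    ∃ Cα Lg : ℝ, 0 < Cα ∧ Cα ≤ 1 ∧ 0 < Lg ∧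
      ∃ δ : ℝ, 0 < δ ∧
        ∀ u₀ : H, u₀ ∈ S.Msphere → ‖u₀‖ = r → ‖u₀ - ustar‖ ≤ δ →
          ∀ (αmin αmax : ℝ) (α : ℕ → ℝ),
            0 < αmin → (∀ n : ℕ, αmin ≤ α n ∧ α n ≤ αmax) → αmax ≤ Cα →
            1 + Lg ^ 2 * αmax ^ 2 - αmax * min 1 ((lam1 - lam0) / (4 * lam0)) < 1 →
            ∀ u : ℕ → H, u 0 = u₀ →
              (∀ n : ℕ, u (n + 1) = S.retract (u n - α n • S.gradRH1 (u n))) →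
              ∃ Cd : ℝ, 0 < Cd ∧ Cd < 1 ∧
                ∀ n : ℕ, ‖u (n + 1) - ustar‖ ≤ Cd * ‖u n - ustar‖ := by
  have hw : S.P ustar ustar = 1 := hgs.1
  obtain ⟨L, c, δ, hL, hc, hc1, hδ, hδ1, hloc⟩ :=
    S.exists_gradRH1_bounds hw heig hlam0 hgap
  obtain ⟨K, hKdef⟩ : ∃ K, K = L ^ 2 / 2 + S.C₃ ^ 2 * L ^ 2 * (‖ustar‖ + 1 + L) := ⟨_, rfl⟩
  have hK : 0 < K := by rw [hKdef]; positivity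
  refine ⟨min 1 (c / (2 * K)), 1, by positivity, min_le_left _ _, one_pos, δ, hδ, ?_⟩
  intro u₀ hu₀ _ hd₀ αmin αmax α hαmin hα hαmax _ u hu0 hstep
  have hα1 : ∀ n, α n ≤ 1 := fun n => (hα n).2.trans (hαmax.trans (min_le_left _ _))
  have hαK : ∀ n, α n * K ≤ c / 2 := fun n => by
    have := (hα n).2.trans (hαmax.trans (min_le_right _ _))
    rw [le_div_iff₀ (by positivity)] at this
    linarith
  have hmin1 : αmin ≤ 1 := (hα 0).1.trans (hα1 0)
  have hone : ∀ n, S.P (u n) (u n) = 1 → ‖u n - ustar‖ ≤ δ →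
      S.P (u (n + 1)) (u (n + 1)) = 1 ∧
        ‖u (n + 1) - ustar‖ ≤ (1 - αmin * c / 2) * ‖u n - ustar‖ := by
    intro n hn hdn
    obtain ⟨hg, hco⟩ := hloc (u n) hn hdn
    obtain ⟨hP, hcontr⟩ := S.step_contraction hL hn (hdn.trans hδ1) hg hco hc1
      (hαmin.trans_le (hα n).1) (hα1 n) (hKdef ▸ hαK n)
    rw [← hstep n] at hP hcontr
    refine ⟨hP, hcontr.trans ?_⟩
    gcongr
    exact (hα n).1
  have hCd : 0 < 1 - αmin * c / 2 ∧ 1 - αmin * c / 2 < 1 := by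
    constructor <;> nlinarith
  have hinv : ∀ n, S.P (u n) (u n) = 1 ∧ ‖u n - ustar‖ ≤ δ := by
    intro n
    induction n with
    | zero => exact ⟨hu0 ▸ hu₀, hu0 ▸ hd₀⟩
    | succ k ih =>
      obtain ⟨hP, hd⟩ := hone k ih.1 ih.2
      exact ⟨hP, hd.trans (by nlinarith [norm_nonneg (u k - ustar)])⟩
  exact ⟨_, hCd.1, hCd.2, fun n => (hone n (hinv n).1 (hinv n).2).2⟩
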